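/- arXiv:2512.05555 — 8 statements merged into one kernel-verified Lean document; each statement's English description precedes it below -/
import Mathlib

section
/- Let a trace be creation-well-formed with main thread t₀, and let x be a position whose event has thread t₀ such that every position whose action is a create occurs strictly after x. Then for every position j whose event's thread differs from t₀, hb x j holds. -/
namespace TSan

/-- Actions an event can perform. -/
inductive Action : Type where
  | read : ℕ → Action
  | write : ℕ → Action
  | lock : ℕ → Action
  | unlock : ℕ → Action
  | create : ℕ → Action
  deriving DecidableEq

/-- An event: a thread identifier together with an action. -/
structure Event : Type where
  thread : ℕ
  act : Action

/-- Program order: earlier position, same thread. -/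
def po (tr : List Event) (i j : Fin tr.length) : Prop :=
  i < j ∧ (tr.get i).thread = (tr.get j).thread

/-- Lock order: unlock of a lock before a later lock of the same lock. -/
def lo (tr : List Event) (i j : Fin tr.length) : Prop :=
  i < j ∧ ∃ l, (tr.get i).act = Action.unlock l ∧ (tr.get j).act = Action.lock l

/-- Creation order: a create of thread t' before a later event of thread t'. -/
def cr (tr : List Event) (i j : Fin tr.length) : Prop :=
  i < j ∧ ∃ t', (tr.get i).act = Action.create t' ∧ (tr.get j).thread = t'

/-- Happens-before: reflexive-transitive closure of po ∪ lo ∪ cr. -/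
def hb (tr : List Event) : Fin tr.length → Fin tr.length → Prop :=
  Relation.ReflTransGen (fun i j => po tr i j ∨ lo tr i j ∨ cr tr i j)

/-- Creation-well-formed with main thread t₀: every position on a thread other
than t₀ is preceded by a create of that thread. -/
def creationWF (tr : List Event) (t₀ : ℕ) : Prop :=
  ∀ j : Fin tr.length, (tr.get j).thread ≠ t₀ →
    ∃ i : Fin tr.length, i < j ∧ (tr.get i).act = Action.create (tr.get j).thread

/-- A main-thread position before all creates happens-before every position of
another thread. -/
theorem stc_hb (tr : List Event) (t₀ : ℕ) (hwf : creationWF tr t₀)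
    (x : Fin tr.length) (hx : (tr.get x).thread = t₀)
    (hcreate : ∀ k : Fin tr.length, (∃ t', (tr.get k).act = Action.create t') → x < k) :
    ∀ j : Fin tr.length, (tr.get j).thread ≠ t₀ → hb tr x j := by
  intro j
  induction j using WellFoundedLT.induction with
  | ind j ih =>
    intro hj
    obtain ⟨i, hij, hact⟩ := hwf j hj
    refine Relation.ReflTransGen.tail ?_ (Or.inr (Or.inr ⟨hij, _, hact, rfl⟩))
    by_cases hi : (tr.get i).thread = t₀
    · exact Relation.ReflTransGen.single (Or.inl ⟨hcreate i ⟨_, hact⟩, hx.trans hi.symm⟩)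
    · exact ih i hij hi

end TSan
end

section
/- (Single-threaded context.) Let a trace be creation-well-formed with main thread t₀, and let x be a position whose event has thread t₀ such that every position whose action is a create occurs strictly after x. Then x does not form a data race with any position of the trace. -/
namespace TSan

/-- An action is a read or write access to memory location ℓ. -/
def isAccess (a : Action) (ℓ : ℕ) : Prop :=
  a = Action.read ℓ ∨ a = Action.write ℓ

/-- Two positions conflict: both access the same location, at least one write. -/
def conflict (tr : List Event) (i j : Fin tr.length) : Prop :=
  ∃ ℓ, isAccess (tr.get i).act ℓ ∧ isAccess (tr.get j).act ℓ ∧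
    ((tr.get i).act = Action.write ℓ ∨ (tr.get j).act = Action.write ℓ)

/-- Data race: a conflict with neither direction of happens-before. -/
def dataRace (tr : List Event) (i j : Fin tr.length) : Prop :=
  conflict tr i j ∧ ¬ hb tr i j ∧ ¬ hb tr j i

/-- A main-thread position before all creates happens before every later position. -/
theorem hb_of_le_of_before_create {tr : List Event} {t₀ : ℕ} (hwf : creationWF tr t₀)
    {x : Fin tr.length} (hx : (tr.get x).thread = t₀)
    (hcreate : ∀ k : Fin tr.length, (∃ t', (tr.get k).act = Action.create t') → x < k)
    (j : Fin tr.length) (hxj : x ≤ j) : hb tr x j := by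
  induction j using WellFoundedLT.induction with
  | ind j ih =>
    by_cases hj : (tr.get j).thread = t₀
    · rcases hxj.eq_or_lt with rfl | hlt
      · exact .refl
      · exact .single (.inl ⟨hlt, hx.trans hj.symm⟩)
    · obtain ⟨i, hij, hi⟩ := hwf j hj
      exact (ih i hij (hcreate i ⟨_, hi⟩).le).tail (.inr (.inr ⟨hij, _, hi, rfl⟩))

/-- Single-threaded context: a main-thread position before all creates races
with no position. -/
theorem stc_no_race (tr : List Event) (t₀ : ℕ) (hwf : creationWF tr t₀)
    (x : Fin tr.length) (hx : (tr.get x).thread = t₀)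
    (hcreate : ∀ k : Fin tr.length, (∃ t', (tr.get k).act = Action.create t') → x < k) :
    ∀ j : Fin tr.length, ¬ dataRace tr x j := by
  rintro j ⟨-, hxj, hjx⟩
  rcases le_or_gt x j with h | h
  · exact hxj (hb_of_le_of_before_create hwf hx hcreate j h)
  · have hj : (tr.get j).thread = t₀ := by
      by_contra hne
      obtain ⟨i, hij, hi⟩ := hwf j hne
      exact lt_asymm (hcreate i ⟨_, hi⟩) (hij.trans h)
    exact hjx (.single (.inl ⟨h, hj.trans hx.symm⟩))

end TSan
end

section
/- (Single-writer/multiple-reader.) Let a trace be creation-well-formed with main thread t₀, and let x be a position whose action is read ℓ. Suppose that every position w whose action is write ℓ has thread t₀ and occurs strictly before every position whose action is a create. Then x does not form a data race with any position of the trace. -/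
namespace TSan

/-- A main-thread position preceding every create happens before everything later. -/
theorem hb_of_lt_of_forall_create {tr : List Event} {t₀ : ℕ} (hwf : creationWF tr t₀)
    {w : Fin tr.length} (hw : (tr.get w).thread = t₀)
    (hc : ∀ c : Fin tr.length, (∃ t', (tr.get c).act = Action.create t') → w < c)
    (j : Fin tr.length) (hj : w < j) : hb tr w j := by
  induction j using WellFoundedLT.induction with
  | ind j ih =>
    by_cases ht : (tr.get j).thread = t₀
    · exact .single (.inl ⟨hj, hw.trans ht.symm⟩)
    · obtain ⟨i, hij, hi⟩ := hwf j ht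
      exact (ih i hij (hc i ⟨_, hi⟩)).tail (.inr (.inr ⟨hij, _, hi, rfl⟩))

/-- A main-thread position preceding every create is comparable with every position. -/
theorem hb_or_hb_of_forall_create {tr : List Event} {t₀ : ℕ} (hwf : creationWF tr t₀)
    {w : Fin tr.length} (hw : (tr.get w).thread = t₀)
    (hc : ∀ c : Fin tr.length, (∃ t', (tr.get c).act = Action.create t') → w < c)
    (j : Fin tr.length) : hb tr j w ∨ hb tr w j := by
  rcases lt_trichotomy j w with h | rfl | h
  · by_cases ht : (tr.get j).thread = t₀
    · exact .inl (.single (.inl ⟨h, ht.trans hw.symm⟩))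
    · obtain ⟨i, hij, hi⟩ := hwf j ht
      exact absurd ((hc i ⟨_, hi⟩).trans hij) h.asymm
  · exact .inl .refl
  · exact .inr (hb_of_lt_of_forall_create hwf hw hc j h)

/-- Single-writer/multiple-reader: a read of ℓ cannot race if all writes to ℓ
are by the main thread and occur before every create. -/
theorem swmr_no_race (tr : List Event) (t₀ : ℕ) (hwf : creationWF tr t₀)
    (ℓ : ℕ) (x : Fin tr.length) (hx : (tr.get x).act = Action.read ℓ)
    (hwrites : ∀ w : Fin tr.length, (tr.get w).act = Action.write ℓ →
      (tr.get w).thread = t₀ ∧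
      ∀ c : Fin tr.length, (∃ t', (tr.get c).act = Action.create t') → w < c) :
    ∀ j : Fin tr.length, ¬ dataRace tr x j := by
  rintro j ⟨⟨m, hxm, -, hwr⟩, hxj, hjx⟩
  have hm : m = ℓ := by
    rcases hxm with h | h <;> simp_all
  subst hm
  have hj : (tr.get j).act = Action.write m := hwr.resolve_left (by rw [hx]; simp)
  obtain ⟨hw, hc⟩ := hwrites j hj
  exact (hb_or_hb_of_forall_create hwf hw hc x).elim hxj hjx

end TSan
end

section
/- (Decomposition of happens-before paths leaving a thread.) For all positions i and j of a trace, if hb i j then either the events at i and j have the same thread and i ≤ j, or there exist positions q and r such that the event at q has the same thread as the event at i, i ≤ q, either lo q r or cr q r holds, and hb r j. -/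
namespace TSan

/-- Decomposition of happens-before paths leaving a thread. -/
theorem hb_decomp_leaving (tr : List Event) (i j : Fin tr.length) (h : hb tr i j) :
    ((tr.get i).thread = (tr.get j).thread ∧ i ≤ j) ∨
    ∃ q r : Fin tr.length, (tr.get q).thread = (tr.get i).thread ∧ i ≤ q ∧
      (lo tr q r ∨ cr tr q r) ∧ hb tr r j := by
  induction h using Relation.ReflTransGen.head_induction_on with
  | refl => exact Or.inl ⟨rfl, le_rfl⟩
  | head hstep htail ih =>
    rcases hstep with ⟨hlt, hthread⟩ | hcross
    · rcases ih with ⟨heq, hle⟩ | ⟨q, r, hq, hle, hqr, hr⟩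
      · exact Or.inl ⟨hthread.trans heq, hlt.le.trans hle⟩
      · exact Or.inr ⟨q, r, hq.trans hthread.symm, hlt.le.trans hle, hqr, hr⟩
    · exact Or.inr ⟨_, _, rfl, le_rfl, hcross, htail⟩

end TSan
end

section
/- (Decomposition of happens-before paths entering a thread.) For all positions i and j of a trace, if hb i j then either the events at i and j have the same thread and i ≤ j, or there exist positions q and r such that either lo q r or cr q r holds, hb i q, the event at r has the same thread as the event at j, and r ≤ j. -/
namespace TSan

/-- Decomposition of happens-before paths entering a thread. -/
theorem hb_decomp_entering (tr : List Event) (i j : Fin tr.length) (h : hb tr i j) :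
    ((tr.get i).thread = (tr.get j).thread ∧ i ≤ j) ∨
    ∃ q r : Fin tr.length, (lo tr q r ∨ cr tr q r) ∧ hb tr i q ∧
      (tr.get r).thread = (tr.get j).thread ∧ r ≤ j := by
  induction h with
  | refl => exact Or.inl ⟨rfl, le_rfl⟩
  | @tail k m hik hkm ih =>
    rcases hkm with ⟨hlt, hthread⟩ | hcross
    · rcases ih with ⟨hik_thread, hle⟩ | ⟨q, r, hqr, hiq, hr_thread, hle⟩
      · exact Or.inl ⟨hik_thread.trans hthread, hle.trans hlt.le⟩
      · exact Or.inr ⟨q, r, hqr, hiq, hr_thread.trans hthread, hle.trans hlt.le⟩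
    · exact Or.inr ⟨k, m, hcross, hik, rfl, le_rfl⟩

end TSan
end

section
/- (Lock ordering.) In a well-locked trace, let x < y be positions whose events have different threads, such that the thread of the event at x holds lock l at x and the thread of the event at y holds lock l at y. Then there exist positions u and v with x < u, the thread at u equal to the thread at x, the action at u equal to unlock l, u < v ≤ y, the thread at v equal to the thread at y, and the action at v equal to lock l; in particular lo u v holds and hence hb x y. -/
namespace TSan

/-- Thread u holds lock l at position i. -/
def holdsLock (tr : List Event) (u l : ℕ) (i : Fin tr.length) : Prop :=
  ∃ j : Fin tr.length, j ≤ i ∧ (tr.get j).thread = u ∧ (tr.get j).act = Action.lock l ∧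
    ∀ k : Fin tr.length, j < k → k ≤ i →
      ¬((tr.get k).thread = u ∧ (tr.get k).act = Action.unlock l)

/-- Well-locked: no other thread still holds a lock when it is acquired. -/
def wellLocked (tr : List Event) : Prop :=
  ∀ i : Fin tr.length, ∀ l, (tr.get i).act = Action.lock l →
    ∀ u, u ≠ (tr.get i).thread →
      ¬ ∃ j : Fin tr.length, j < i ∧ (tr.get j).thread = u ∧ (tr.get j).act = Action.lock l ∧
        ∀ k : Fin tr.length, j < k → k < i →
          ¬((tr.get k).thread = u ∧ (tr.get k).act = Action.unlock l)

/-- Lock ordering: in a well-locked trace, if two positions on different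
threads both hold lock l, the earlier thread unlocks before the later locks. -/
theorem lock_ordering (tr : List Event) (hwl : wellLocked tr)
    (l : ℕ) (x y : Fin tr.length) (hxy : x < y)
    (hth : (tr.get x).thread ≠ (tr.get y).thread)
    (hx : holdsLock tr (tr.get x).thread l x)
    (hy : holdsLock tr (tr.get y).thread l y) :
    (∃ u v : Fin tr.length, x < u ∧ (tr.get u).thread = (tr.get x).thread ∧
      (tr.get u).act = Action.unlock l ∧ u < v ∧ v ≤ y ∧
      (tr.get v).thread = (tr.get y).thread ∧ (tr.get v).act = Action.lock l ∧
      lo tr u v) ∧ hb tr x y := by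
  obtain ⟨a, hax, hat, haa, hau⟩ := hx
  obtain ⟨b, hby, hbt, hba, hbu⟩ := hy
  have hab : a < b := by
    rcases lt_trichotomy a b with h | h | h
    · exact h
    · exact absurd (by rw [← hat, ← hbt, h]) hth
    · exact absurd
        ⟨b, h, hbt, hba, fun k hbk hka => hbu k hbk (hka.le.trans (hax.trans hxy.le))⟩
        (hwl a l haa _ (by rw [hat]; exact hth.symm))
  obtain ⟨u, hau', hub, hut, huu⟩ : ∃ u : Fin tr.length, a < u ∧ u < b ∧
      (tr.get u).thread = (tr.get x).thread ∧ (tr.get u).act = Action.unlock l := by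
    by_contra hno
    exact hwl b l hba _ (by rw [hbt]; exact hth)
      ⟨a, hab, hat, haa, fun k hak hkb hk => hno ⟨k, hak, hkb, hk⟩⟩
  have hxu : x < u := by
    by_contra hle
    exact hau u hau' (not_lt.mp hle) ⟨hut, huu⟩
  have hlo : lo tr u b := ⟨hub, l, huu, hba⟩
  refine ⟨⟨u, b, hxu, hut, huu, hub, hby, hbt, hba, hlo⟩, ?_⟩
  have hxb : hb tr x b := .tail (.single (.inl ⟨hxu, hut.symm⟩)) (.inr (.inl hlo))
  rcases hby.eq_or_lt with h | h
  · exact h ▸ hxb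
  · exact hxb.tail (.inl ⟨h, hbt⟩)

end TSan
end

section
/- (Lock protection.) In a well-locked trace, if x and y are positions such that for some lock l the thread of the event at x holds l at x and the thread of the event at y holds l at y, then hb x y or hb y x; consequently x and y do not form a data race. -/
namespace TSan

theorem hb_of_le_of_thread_eq {tr : List Event} {i j : Fin tr.length} (hij : i ≤ j)
    (ht : (tr.get i).thread = (tr.get j).thread) : hb tr i j := by
  rcases hij.eq_or_lt with rfl | hlt
  · exact Relation.ReflTransGen.refl
  · exact Relation.ReflTransGen.single (Or.inl ⟨hlt, ht⟩)

/-- If the acquisition of `l` protecting `x` precedes the acquisition by another thread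
protecting `y`, then `x` happens before `y`. -/
theorem hb_of_lock_lt_lock {tr : List Event} (hwl : wellLocked tr) {x y i j : Fin tr.length}
    {l : ℕ} (hne : (tr.get x).thread ≠ (tr.get y).thread) (hij : i < j)
    (hi : (tr.get i).thread = (tr.get x).thread) (hil : (tr.get i).act = Action.lock l)
    (hix : ∀ k : Fin tr.length, i < k → k ≤ x →
      ¬((tr.get k).thread = (tr.get x).thread ∧ (tr.get k).act = Action.unlock l))
    (hjy : j ≤ y) (hj : (tr.get j).thread = (tr.get y).thread)
    (hjl : (tr.get j).act = Action.lock l) : hb tr x y := by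
  obtain ⟨k, hik, hkj, hkt, hkl⟩ : ∃ k : Fin tr.length, i < k ∧ k < j ∧
      (tr.get k).thread = (tr.get x).thread ∧ (tr.get k).act = Action.unlock l := by
    by_contra hk
    exact hwl j l hjl _ (hj ▸ hne)
      ⟨i, hij, hi, hil, fun k hik hkj hku => hk ⟨k, hik, hkj, hku⟩⟩
  have hxk : x ≤ k := le_of_not_ge fun hkx => hix k hik hkx ⟨hkt, hkl⟩
  have hkj' : hb tr k j := Relation.ReflTransGen.single (Or.inr (Or.inl ⟨hkj, l, hkl, hjl⟩))
  exact ((hb_of_le_of_thread_eq hxk hkt.symm).trans hkj').trans (hb_of_le_of_thread_eq hjy hj)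

/-- Lock protection: in a well-locked trace, two positions holding a common
lock are happens-before ordered, hence do not race. -/
theorem lock_protection (tr : List Event) (hwl : wellLocked tr)
    (x y : Fin tr.length)
    (h : ∃ l, holdsLock tr (tr.get x).thread l x ∧ holdsLock tr (tr.get y).thread l y) :
    (hb tr x y ∨ hb tr y x) ∧ ¬ dataRace tr x y := by
  suffices hxy : hb tr x y ∨ hb tr y x from
    ⟨hxy, fun hrace => hxy.elim hrace.2.1 hrace.2.2⟩
  by_cases ht : (tr.get x).thread = (tr.get y).thread
  · exact (le_total x y).imp (hb_of_le_of_thread_eq · ht) (hb_of_le_of_thread_eq · ht.symm)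
  obtain ⟨l, ⟨i, hix, hi, hil, hi_held⟩, ⟨j, hjy, hj, hjl, hj_held⟩⟩ := h
  rcases lt_trichotomy i j with hij | rfl | hji
  · exact Or.inl (hb_of_lock_lt_lock hwl ht hij hi hil hi_held hjy hj hjl)
  · exact absurd (hi.symm.trans hj) ht
  · exact Or.inr (hb_of_lock_lt_lock hwl (Ne.symm ht) hji hj hjl hj_held hix hi hil)

end TSan
end

section
/- (Post-dominance-based race transfer.) Assume the trace respects thread creation. Let a ≤ a' be positions whose events have the same thread t, such that: the actions at a and a' are read or write accesses to the same memory location; if the action at a is a write then the action at a' is a write; and no position k with a < k ≤ a' whose event has thread t has a lock action. Then for every position b, if a forms a data race with b, then a' forms a data race with b. -/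
namespace TSan

/-- The trace respects thread creation: any create of a thread precedes all of
that thread's events. -/
def respectsCreation (tr : List Event) : Prop :=
  ∀ i j : Fin tr.length, ∀ t'' : ℕ,
    (tr.get i).act = Action.create t'' → (tr.get j).thread = t'' → i < j

theorem hb_of_le {tr : List Event} {i j : Fin tr.length} (hij : i ≤ j)
    (h : (tr.get i).thread = (tr.get j).thread) : hb tr i j := by
  rcases hij.eq_or_lt with rfl | hlt
  · exact Relation.ReflTransGen.refl
  · exact Relation.ReflTransGen.single (Or.inl ⟨hlt, h⟩)

theorem isAccess.unique {x : Action} {m n : ℕ} (hm : isAccess x m) (hn : isAccess x n) :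
    m = n := by
  rcases hm with rfl | rfl <;> simpa [isAccess] using hn

/-- Anything ordered before a position that is reachable from `a` along its own thread without
a lock action is already ordered with `a`. -/
theorem hb_or_hb_of_lock_free {tr : List Event} (hrc : respectsCreation tr)
    {a b k : Fin tr.length} (hbk : hb tr b k) (hak : a ≤ k)
    (hthread : (tr.get k).thread = (tr.get a).thread)
    (hfree : ∀ m : Fin tr.length, a < m → m ≤ k → (tr.get m).thread = (tr.get a).thread →
      ¬ ∃ l, (tr.get m).act = Action.lock l) :
    hb tr b a ∨ hb tr a b := by
  induction hbk with
  | refl => exact Or.inr (hb_of_le hak hthread.symm)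
  | @tail x k hbx hxk ih =>
    rcases hak.eq_or_lt with rfl | hlt
    · exact Or.inl (hbx.tail hxk)
    rcases hxk with ⟨hx, hpo⟩ | ⟨-, l, -, hlock⟩ | ⟨-, t', hcreate, ht'⟩
    · rcases le_or_gt a x with hax | hxa
      · exact ih hax (hpo.trans hthread) fun m ham hmx => hfree m ham (hmx.trans hx.le)
      · exact Or.inl (hbx.tail (Or.inl ⟨hxa, hpo.trans hthread⟩))
    · exact absurd ⟨l, hlock⟩ (hfree k hlt le_rfl hthread)
    · have hat : (tr.get a).thread = t' := hthread.symm.trans ht'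
      exact Or.inl (hbx.tail (Or.inr (Or.inr ⟨hrc x a t' hcreate hat, t', hcreate, hat⟩)))

/-- Post-dominance-based race transfer: a race at an access `a` transfers to
the post-dominating access `a'` when no intervening same-thread acquire-like
(lock) action occurs. -/
theorem postdominance_race_transfer (tr : List Event) (hrc : respectsCreation tr)
    (t : ℕ) (a a' : Fin tr.length) (haa : a ≤ a')
    (hta : (tr.get a).thread = t) (hta' : (tr.get a').thread = t)
    (hacc : ∃ ℓ, isAccess (tr.get a).act ℓ ∧ isAccess (tr.get a').act ℓ ∧
      ((tr.get a).act = Action.write ℓ → (tr.get a').act = Action.write ℓ))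
    (hclean : ∀ k : Fin tr.length, a < k → k ≤ a' → (tr.get k).thread = t →
      ¬ ∃ l, (tr.get k).act = Action.lock l) :
    ∀ b : Fin tr.length, dataRace tr a b → dataRace tr a' b := by
  subst hta
  rintro b ⟨⟨m, ham, hbm, hw⟩, hab, hba⟩
  obtain ⟨n, han, ha'n, hww⟩ := hacc
  obtain rfl := ham.unique han
  refine ⟨⟨m, ha'n, hbm, hw.imp_left hww⟩, fun h => ?_, fun h => ?_⟩
  · exact hab ((hb_of_le haa hta'.symm).trans h)
  · exact (hb_or_hb_of_lock_free hrc h haa hta' hclean).elim hba hab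

end TSan
end
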